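/- arXiv:1312.3600 — 5 statements merged into one kernel-verified Lean document; each statement's English description precedes it below -/
import Mathlib

section
/- Let δ be a real number with 0 < δ < 1/2 and set μ = (1 − √(1 − 4δ²))/(2δ). Let (x_k)_{k∈ℕ} be a bounded sequence of nonnegative real numbers satisfying x_k ≤ δ·(x_{k−1} + x_{k+1}) for every integer k ≥ 1. Then x_k ≤ x₀·μ^k for every k ∈ ℕ. -/
/-- A sequence bounded above with `d k ≤ μ d (k+1)`, where `0 ≤ μ < 1`, is nonpositive. -/
theorem nonpos_of_le_mul_succ {μ C : ℝ} (hμ0 : 0 ≤ μ) (hμ1 : μ < 1) {d : ℕ → ℝ}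
    (hC : ∀ k, d k ≤ C) (hd : ∀ k, d k ≤ μ * d (k + 1)) (k : ℕ) : d k ≤ 0 := by
  have hiter (n : ℕ) : d k ≤ μ ^ n * d (k + n) := by
    induction n with
    | zero => simp
    | succ n ih =>
      calc d k ≤ μ ^ n * d (k + n) := ih
        _ ≤ μ ^ n * (μ * d (k + n + 1)) := by gcongr; exact hd _
        _ = μ ^ (n + 1) * d (k + (n + 1)) := by rw [pow_succ, mul_assoc, add_assoc]
  have hlim : Filter.Tendsto (fun n : ℕ => μ ^ n * C) Filter.atTop (nhds 0) := by
    simpa using (tendsto_pow_atTop_nhds_zero_of_lt_one hμ0 hμ1).mul_const C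
  exact ge_of_tendsto' hlim fun n =>
    (hiter n).trans (mul_le_mul_of_nonneg_left (hC _) (pow_nonneg hμ0 n))

/-- The smaller root of `δ t² - t + δ = 0` lies in `(0, 1)`. -/
theorem smaller_root_spec {δ : ℝ} (hδ0 : 0 < δ) (hδ1 : δ < 1 / 2) {μ : ℝ}
    (hμ : μ = (1 - Real.sqrt (1 - 4 * δ ^ 2)) / (2 * δ)) :
    0 < μ ∧ μ < 1 ∧ δ * (1 + μ ^ 2) = μ := by
  have hsq : Real.sqrt (1 - 4 * δ ^ 2) ^ 2 = 1 - 4 * δ ^ 2 := Real.sq_sqrt (by nlinarith)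
  have hs0 : 0 ≤ Real.sqrt (1 - 4 * δ ^ 2) := Real.sqrt_nonneg _
  generalize Real.sqrt (1 - 4 * δ ^ 2) = s at hμ hsq hs0
  subst hμ
  refine ⟨div_pos (by nlinarith) (by positivity), ?_, ?_⟩
  · rw [div_lt_one (by positivity)]
    nlinarith
  · field_simp
    linear_combination hsq


/-- Discrete one-sided maximum principle: a bounded nonnegative sequence satisfying
`x k ≤ δ (x (k-1) + x (k+1))` for `k ≥ 1` decays like `μ^k`, where
`μ = (1 - √(1 - 4δ²))/(2δ)` is the smaller root of `δ t² - t + δ = 0`. -/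
theorem discrete_max_principle_infinite
    (δ : ℝ) (hδ0 : 0 < δ) (hδ1 : δ < 1 / 2)
    (μ : ℝ) (hμ : μ = (1 - Real.sqrt (1 - 4 * δ ^ 2)) / (2 * δ))
    (x : ℕ → ℝ)
    (hbdd : ∃ C : ℝ, ∀ k : ℕ, x k ≤ C)
    (hnonneg : ∀ k : ℕ, 0 ≤ x k)
    (hrec : ∀ k : ℕ, 1 ≤ k → x k ≤ δ * (x (k - 1) + x (k + 1))) :
    ∀ k : ℕ, x k ≤ x 0 * μ ^ k := by
  obtain ⟨hμ0, hμ1, hroot⟩ := smaller_root_spec hδ0 hδ1 hμ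
  obtain ⟨C, hC⟩ := hbdd
  have hstep : ∀ k, x (k + 1) - μ * x k ≤ 0 := by
    refine nonpos_of_le_mul_succ (C := C) hμ0.le hμ1
      (fun k => by linarith [hC (k + 1), mul_nonneg hμ0.le (hnonneg k)]) fun k => ?_
    have h := hrec (k + 1) (Nat.le_add_left 1 k)
    rw [Nat.add_sub_cancel] at h
    refine le_of_mul_le_mul_left ?_ hδ0
    linear_combination μ * h + x (k + 1) * hroot
  intro k
  induction k with
  | zero => simp
  | succ k ih =>
    calc x (k + 1) ≤ μ * x k := by linarith [hstep k]
      _ ≤ μ * (x 0 * μ ^ k) := by gcongr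
      _ = x 0 * μ ^ (k + 1) := by ring
end

section
/- Let δ be a real number with 0 < δ < 1/2, set μ = (1 − √(1 − 4δ²))/(2δ), let K ≥ 1 be an integer, and let x₀, x₁, …, x_K be nonnegative real numbers satisfying x_k ≤ δ·(x_{k−1} + x_{k+1}) for every integer k with 1 ≤ k ≤ K − 1. Then x_k ≤ x₀·μ^k + x_K·μ^{K−k} for every integer k with 0 ≤ k ≤ K. -/
/-- Discrete maximum principle: a sequence on `0, …, K` that is nonpositive at both ends and
satisfies `z k ≤ δ (z (k-1) + z (k+1))` in between, with `δ < 1/2`, is nonpositive. -/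
theorem nonpos_of_le_mul_neighbors {δ : ℝ} (hδ0 : 0 ≤ δ) (hδ1 : δ < 1 / 2) {K : ℕ} {z : ℕ → ℝ}
    (h0 : z 0 ≤ 0) (hK : z K ≤ 0)
    (hrec : ∀ k : ℕ, 1 ≤ k → k ≤ K - 1 → z k ≤ δ * (z (k - 1) + z (k + 1)))
    {k : ℕ} (hk : k ≤ K) : z k ≤ 0 := by
  obtain ⟨m, hm, hmax⟩ := Finset.exists_max_image (Finset.range (K + 1)) z ⟨0, by simp⟩
  simp only [Finset.mem_range, Nat.lt_succ_iff] at hm hmax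
  refine (hmax k hk).trans ?_
  by_contra! hpos
  have hm0 : m ≠ 0 := by rintro rfl; linarith
  have hmK : m ≠ K := by rintro rfl; linarith
  have hle := hrec m (by omega) (by omega)
  have hsum : z (m - 1) + z (m + 1) ≤ 2 * z m := by
    linarith [hmax (m - 1) (by omega), hmax (m + 1) (by omega)]
  nlinarith [mul_le_mul_of_nonneg_left hsum hδ0]

/-- Finite two-sided discrete maximum principle: nonnegative numbers `x 0, …, x K`
satisfying `x k ≤ δ (x (k-1) + x (k+1))` for `1 ≤ k ≤ K - 1` obey
`x k ≤ x 0 * μ^k + x K * μ^(K - k)`, where `μ = (1 - √(1 - 4δ²))/(2δ)`. -/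
theorem discrete_max_principle_finite
    (δ : ℝ) (hδ0 : 0 < δ) (hδ1 : δ < 1 / 2)
    (μ : ℝ) (hμ : μ = (1 - Real.sqrt (1 - 4 * δ ^ 2)) / (2 * δ))
    (K : ℕ) (hK : 1 ≤ K)
    (x : ℕ → ℝ)
    (hnonneg : ∀ k : ℕ, k ≤ K → 0 ≤ x k)
    (hrec : ∀ k : ℕ, 1 ≤ k → k ≤ K - 1 → x k ≤ δ * (x (k - 1) + x (k + 1))) :
    ∀ k : ℕ, k ≤ K → x k ≤ x 0 * μ ^ k + x K * μ ^ (K - k) := by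
  have hsq : Real.sqrt (1 - 4 * δ ^ 2) ^ 2 = 1 - 4 * δ ^ 2 := Real.sq_sqrt (by nlinarith)
  have hμ0 : 0 ≤ μ := by
    rw [hμ]
    have : Real.sqrt (1 - 4 * δ ^ 2) ≤ 1 := Real.sqrt_le_one.mpr (by nlinarith)
    exact div_nonneg (by linarith) (by linarith)
  have hroot : δ * (1 + μ ^ 2) = μ := by
    rw [hμ]
    generalize Real.sqrt (1 - 4 * δ ^ 2) = s at hsq
    field_simp
    linear_combination hsq
  have hx0 := hnonneg 0 (Nat.zero_le K)
  have hxK := hnonneg K le_rfl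
  intro k hk
  refine sub_nonpos.mp (nonpos_of_le_mul_neighbors (K := K)
    (z := fun j => x j - (x 0 * μ ^ j + x K * μ ^ (K - j))) hδ0.le hδ1 ?_ ?_ ?_ hk)
  · have : 0 ≤ x K * μ ^ K := by positivity
    simpa using this
  · have : 0 ≤ x 0 * μ ^ K := by positivity
    simpa using this
  · intro j hj1 hjK
    obtain ⟨i, rfl⟩ := Nat.exists_eq_add_of_le' hj1
    obtain ⟨n, rfl⟩ : ∃ n, K = i + 2 + n := Nat.exists_eq_add_of_le (by omega)
    have hle := hrec (i + 1) hj1 hjK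
    have e1 : i + 2 + n - (i + 1) = n + 1 := by omega
    have e2 : i + 2 + n - i = n + 2 := by omega
    have e3 : i + 2 + n - (i + 1 + 1) = n := by omega
    simp only [Nat.add_sub_cancel, e1, e2, e3] at hle ⊢
    linear_combination hle + (x 0 * μ ^ i + x (i + 2 + n) * μ ^ n) * hroot
end

section
/- Let r, ρ, c be positive real numbers with 2c < r^{1/2}·ρ. Let (x_k)_{k∈ℕ} be a bounded sequence of nonnegative real numbers satisfying x_k ≤ c·r^{−1/2}·ρ^{−1}·(x_{k+1} + x_{k−1}) for every integer k ≥ 1. Then x_k ≤ x₀·(2c·r^{−1/2}·ρ^{−1})^k for every k ∈ ℕ. -/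
open Filter Topology in
/-- A bounded nonnegative sequence with `x (k+1) ≤ δ (x (k+2) + x k)` decays geometrically with any
ratio `μ ∈ (0, 1)` that is a root of `δ t² - t + δ`. -/
theorem succ_le_mul_of_le_mul_add {δ μ : ℝ} (hδ : 0 < δ) (hμ : 0 < μ) (hμ1 : μ < 1)
    (hroot : δ * μ ^ 2 - μ + δ = 0) {x : ℕ → ℝ} {C : ℝ} (hC : ∀ k, x k ≤ C)
    (hnonneg : ∀ k, 0 ≤ x k) (hrec : ∀ k, x (k + 1) ≤ δ * (x (k + 2) + x k)) (k : ℕ) :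
    x (k + 1) ≤ μ * x k := by
  have step (j : ℕ) : x (j + 1) - μ * x j ≤ μ * (x (j + 2) - μ * x (j + 1)) := by
    have h := mul_le_mul_of_nonneg_left (hrec j) hμ.le
    refine le_of_mul_le_mul_left ?_ hδ
    linear_combination h + (x (j + 1)) * hroot
  have iter (n : ℕ) :
      x (k + 1) - μ * x k ≤ μ ^ n * (x (k + n + 1) - μ * x (k + n)) := by
    induction n with
    | zero => simp
    | succ n ih =>
      refine ih.trans ?_
      rw [pow_succ, mul_assoc]
      exact mul_le_mul_of_nonneg_left (step (k + n)) (by positivity)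
  have bound (n : ℕ) : x (k + 1) - μ * x k ≤ μ ^ n * C :=
    (iter n).trans <| mul_le_mul_of_nonneg_left
      (by linarith [hC (k + n + 1), mul_nonneg hμ.le (hnonneg (k + n))]) (by positivity)
  have lim : Tendsto (fun n : ℕ => μ ^ n * C) atTop (𝓝 0) := by
    simpa using (tendsto_pow_atTop_nhds_zero_of_lt_one hμ.le hμ1).mul_const C
  linarith [ge_of_tendsto' lim bound]

/-- For `δ ∈ (0, 1/2)`, the polynomial `δ t² - t + δ` has a root in `(0, 2δ]`. -/
theorem exists_root_le_two_mul {δ : ℝ} (hδ : 0 < δ) (hδ2 : 2 * δ < 1) :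
    ∃ μ : ℝ, 0 < μ ∧ μ ≤ 2 * δ ∧ δ * μ ^ 2 - μ + δ = 0 := by
  have hd : 0 ≤ 1 - 4 * δ ^ 2 := by nlinarith
  have hs := Real.sq_sqrt hd
  have hs0 := Real.sqrt_nonneg (1 - 4 * δ ^ 2)
  set s := Real.sqrt (1 - 4 * δ ^ 2)
  have hs1 : s < 1 := by nlinarith
  refine ⟨(1 - s) / (2 * δ), div_pos (by linarith) (by linarith), ?_, ?_⟩
  · rw [div_le_iff₀ (by linarith)]
    nlinarith
  · field_simp
    linear_combination hs

/-- Quantitative exponential decay: if `2c < √r · ρ` and a bounded nonnegative sequence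
satisfies `x k ≤ c r^{-1/2} ρ⁻¹ (x (k+1) + x (k-1))` for `k ≥ 1`, then
`x k ≤ x 0 * (2 c r^{-1/2} ρ⁻¹)^k`. -/
theorem discrete_decay_quantitative
    (r ρ c : ℝ) (hr : 0 < r) (hρ : 0 < ρ) (hc : 0 < c)
    (hsmall : 2 * c < Real.sqrt r * ρ)
    (x : ℕ → ℝ)
    (hbdd : ∃ C : ℝ, ∀ k : ℕ, x k ≤ C)
    (hnonneg : ∀ k : ℕ, 0 ≤ x k)
    (hrec : ∀ k : ℕ, 1 ≤ k →
      x k ≤ c * (Real.sqrt r)⁻¹ * ρ⁻¹ * (x (k + 1) + x (k - 1))) :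
    ∀ k : ℕ, x k ≤ x 0 * (2 * c * (Real.sqrt r)⁻¹ * ρ⁻¹) ^ k := by
  obtain ⟨C, hC⟩ := hbdd
  have hs : 0 < Real.sqrt r := Real.sqrt_pos.mpr hr
  have hδ : 0 < c * (Real.sqrt r)⁻¹ * ρ⁻¹ := by positivity
  have hδ2 : 2 * (c * (Real.sqrt r)⁻¹ * ρ⁻¹) < 1 := by
    have : 2 * (c * (Real.sqrt r)⁻¹ * ρ⁻¹) = 2 * c / (Real.sqrt r * ρ) := by
      field_simp
    rw [this, div_lt_one (by positivity)]
    exact hsmall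
  have hassoc : 2 * c * (Real.sqrt r)⁻¹ * ρ⁻¹ = 2 * (c * (Real.sqrt r)⁻¹ * ρ⁻¹) := by ring
  rw [hassoc]
  obtain ⟨μ, hμ, hμδ, hroot⟩ := exists_root_le_two_mul hδ hδ2
  have hdecay := succ_le_mul_of_le_mul_add hδ hμ (hμδ.trans_lt hδ2) hroot hC hnonneg
    fun k => hrec (k + 1) (by lia)
  intro k
  induction k with
  | zero => simp
  | succ k ih =>
    calc x (k + 1) ≤ μ * x k := hdecay k
      _ ≤ 2 * (c * (Real.sqrt r)⁻¹ * ρ⁻¹) *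
          (x 0 * (2 * (c * (Real.sqrt r)⁻¹ * ρ⁻¹)) ^ k) :=
        mul_le_mul hμδ ih (hnonneg k) (by positivity)
      _ = x 0 * (2 * (c * (Real.sqrt r)⁻¹ * ρ⁻¹)) ^ (k + 1) := by ring
end

section
/- Let ζ : ℝ → ℝ be differentiable with ζ(x) ≥ 0 for all x, let L : ℝ → ℝ be continuous, suppose that ζ′(x) = −2ζ(x) + 2L(x) for every x ∈ ℝ, and let c ≥ 0 be such that L(x) ≥ −c for every x ∈ ℝ. Then for every s ∈ ℝ, ζ(s) ≤ e⁴·( ∫_{s+1}^{s+2} ζ(x) dx + c ). -/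
/-- If `f' ≥ -k (f + c)`, then `e^{kx} (f x + c)` is nondecreasing. -/
theorem monotone_exp_mul_add_const {f : ℝ → ℝ} {k c : ℝ} (hf : Differentiable ℝ f)
    (h : ∀ x, -k * (f x + c) ≤ deriv f x) :
    Monotone fun x => Real.exp (k * x) * (f x + c) := by
  have hd (x : ℝ) : HasDerivAt (fun x => Real.exp (k * x) * (f x + c))
      (Real.exp (k * x) * (k * 1) * (f x + c) + Real.exp (k * x) * deriv f x) x :=
    (((hasDerivAt_id x).const_mul k).exp).mul ((hf x).hasDerivAt.add_const c)
  refine monotone_of_deriv_nonneg (fun x => (hd x).differentiableAt) fun x => ?_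
  rw [(hd x).deriv]
  have := mul_nonneg (Real.exp_pos (k * x)).le (sub_nonneg.2 (h x))
  linarith

/-- Averaged upper bound for the ODE `ζ' = -2ζ + 2L` with `ζ ≥ 0` and `L ≥ -c`:
`ζ(s) ≤ e⁴ (∫_{s+1}^{s+2} ζ + c)`. -/
theorem ode_averaged_upper_bound
    (ζ L : ℝ → ℝ)
    (hζ : Differentiable ℝ ζ) (hζnn : ∀ x : ℝ, 0 ≤ ζ x)
    (hL : Continuous L)
    (hode : ∀ x : ℝ, deriv ζ x = -2 * ζ x + 2 * L x)
    (c : ℝ) (hc : 0 ≤ c)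
    (hLc : ∀ x : ℝ, L x ≥ -c) :
    ∀ s : ℝ, ζ s ≤ Real.exp 4 * ((∫ x in (s + 1)..(s + 2), ζ x) + c) := by
  intro s
  have hmono : Monotone fun x => Real.exp (2 * x) * (ζ x + c) :=
    monotone_exp_mul_add_const hζ fun x => by linarith [hode x, hLc x]
  have hlower : ∀ x ∈ Set.Icc (s + 1) (s + 2), Real.exp (-4) * ζ s - c ≤ ζ x := by
    intro x hx
    have hle : Real.exp (2 * s) * (ζ s + c) ≤ Real.exp (2 * x) * (ζ x + c) :=
      hmono (by linarith [hx.1])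
    have hexp : Real.exp (2 * x) ≤ Real.exp (2 * s) * Real.exp 4 := by
      rw [← Real.exp_add]
      exact Real.exp_le_exp.2 (by linarith [hx.2])
    have hx0 : 0 ≤ ζ x + c := add_nonneg (hζnn x) hc
    have hs : ζ s + c ≤ Real.exp 4 * (ζ x + c) := by
      refine le_of_mul_le_mul_left ?_ (Real.exp_pos (2 * s))
      calc Real.exp (2 * s) * (ζ s + c) ≤ Real.exp (2 * x) * (ζ x + c) := hle
        _ ≤ Real.exp (2 * s) * Real.exp 4 * (ζ x + c) := by gcongr
        _ = Real.exp (2 * s) * (Real.exp 4 * (ζ x + c)) := by ring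
    have : Real.exp (-4) * ζ s ≤ ζ x + c := by
      rw [Real.exp_neg, inv_mul_le_iff₀ (Real.exp_pos 4)]
      linarith
    linarith
  have hint := intervalIntegral.integral_mono_on (μ := MeasureTheory.volume)
    (by linarith : s + 1 ≤ s + 2)
    intervalIntegrable_const (hζ.continuous.intervalIntegrable (s + 1) (s + 2)) hlower
  rw [intervalIntegral.integral_const, smul_eq_mul] at hint
  rw [← inv_mul_le_iff₀ (Real.exp_pos 4), ← Real.exp_neg]
  linarith
end

section
/- Let C, ρ, ℓ, A be positive real numbers and N a real number with A·ℓ > N and π·ρ·C > N. Let f, g : ℝ → ℝ and f′, g′ : ℝ → ℝ be functions such that for every r ∈ (0, ρ]: f has derivative f′(r) at r and g has derivative g′(r) at r; f′(r) ≤ 0 and g′(r) ≥ 0; f(r) ≥ 0; f′(r) and g′(r) are not both zero; and f′(r) = 0 implies f(r) = A. Suppose also that f(r) = A for every r ∈ (0, 2ρ/3], and that g(2ρ/3) > 3C/4. Then for every r₀ ∈ (0, ρ] and all nonnegative integers m, n which are not both zero and which satisfy −f′(r₀)·ℓ·n = 2π·r₀·m·g′(r₀), one has f(r₀)·ℓ·n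 + g(r₀)·2π·r₀·m > N. -/
/-- Action bound for closed Reeb orbits of the contact form `f(r) dθ + g(r) dt` on the
glued solid torus: under the stated monotonicity and profile conditions on `(f, g)`,
every closed Reeb orbit, occurring at radius `r₀` where `-f'(r₀) ℓ n = 2π r₀ m g'(r₀)`
for nonnegative integers `m, n` not both zero, has action
`f(r₀) ℓ n + g(r₀) 2π r₀ m > N`. -/
theorem torus_reeb_action_bound
    (C ρ ℓ A N : ℝ)
    (hC : 0 < C) (hρ : 0 < ρ) (hℓ : 0 < ℓ) (hA : 0 < A)
    (hAℓ : A * ℓ > N) (hπρC : Real.pi * ρ * C > N)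
    (f g f' g' : ℝ → ℝ)
    (hf : ∀ r ∈ Set.Ioc (0 : ℝ) ρ, HasDerivAt f (f' r) r)
    (hg : ∀ r ∈ Set.Ioc (0 : ℝ) ρ, HasDerivAt g (g' r) r)
    (hf' : ∀ r ∈ Set.Ioc (0 : ℝ) ρ, f' r ≤ 0)
    (hg' : ∀ r ∈ Set.Ioc (0 : ℝ) ρ, 0 ≤ g' r)
    (hfnn : ∀ r ∈ Set.Ioc (0 : ℝ) ρ, 0 ≤ f r)
    (hnotboth : ∀ r ∈ Set.Ioc (0 : ℝ) ρ, ¬(f' r = 0 ∧ g' r = 0))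
    (hfA : ∀ r ∈ Set.Ioc (0 : ℝ) ρ, f' r = 0 → f r = A)
    (hconst : ∀ r ∈ Set.Ioc (0 : ℝ) (2 * ρ / 3), f r = A)
    (hg23 : g (2 * ρ / 3) > 3 * C / 4) :
    ∀ r₀ ∈ Set.Ioc (0 : ℝ) ρ, ∀ m n : ℕ, ¬(m = 0 ∧ n = 0) →
      -f' r₀ * ℓ * (n : ℝ) = 2 * Real.pi * r₀ * (m : ℝ) * g' r₀ →
      f r₀ * ℓ * (n : ℝ) + g r₀ * (2 * Real.pi * r₀ * (m : ℝ)) > N := by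
  intro r₀ hr m n hmn horb
  obtain ⟨hr0, hrρ⟩ := hr
  have hfr := hfnn r₀ ⟨hr0, hrρ⟩
  rcases Nat.eq_zero_or_pos m with rfl | hm
  · have hn : (1 : ℝ) ≤ n := by
      have : 1 ≤ n := by omega
      exact_mod_cast this
    have hf0 : f' r₀ = 0 := by
      have hne : ℓ * (n : ℝ) ≠ 0 := by positivity
      have h : f' r₀ * (ℓ * (n : ℝ)) = 0 := by
        push_cast at horb
        linarith
      exact (mul_eq_zero.mp h).resolve_right hne
    rw [hfA r₀ ⟨hr0, hrρ⟩ hf0]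
    have hle : A * ℓ * 1 ≤ A * ℓ * n := mul_le_mul_of_nonneg_left hn (by positivity)
    push_cast
    linarith
  have hm1 : (1 : ℝ) ≤ m := by exact_mod_cast hm
  rcases lt_or_ge r₀ (2 * ρ / 3) with hlt | hge
  · have hf0 : f' r₀ = 0 := by
      have hev : f =ᶠ[nhds r₀] fun _ => A := by
        filter_upwards [Ioo_mem_nhds hr0 hlt] with r hr
        exact hconst r ⟨hr.1, hr.2.le⟩
      exact (hf r₀ ⟨hr0, hrρ⟩).unique ((hasDerivAt_const r₀ A).congr_of_eventuallyEq hev)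
    have hg0 : g' r₀ = 0 := by
      have hne : 2 * Real.pi * r₀ * (m : ℝ) ≠ 0 := by positivity
      rw [hf0] at horb
      have h : 2 * Real.pi * r₀ * (m : ℝ) * g' r₀ = 0 := by linarith
      exact (mul_eq_zero.mp h).resolve_left hne
    exact absurd ⟨hf0, hg0⟩ (hnotboth r₀ ⟨hr0, hrρ⟩)
  · have hsub : ∀ r ∈ Set.Icc (2 * ρ / 3) ρ, r ∈ Set.Ioc (0 : ℝ) ρ := fun r hr =>
      ⟨lt_of_lt_of_le (by positivity) hr.1, hr.2⟩
    have hmono : MonotoneOn g (Set.Icc (2 * ρ / 3) ρ) := by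
      refine monotoneOn_of_hasDerivWithinAt_nonneg (f' := g') (convex_Icc _ _)
        (fun r hr => (hg r (hsub r hr)).continuousAt.continuousWithinAt)
        (fun r hr => (hg r (hsub r (interior_subset hr))).hasDerivWithinAt)
        (fun r hr => hg' r (hsub r (interior_subset hr)))
    have hgr : 3 * C / 4 < g r₀ :=
      hg23.trans_le (hmono ⟨le_rfl, by linarith⟩ ⟨hge, hrρ⟩ hge)
    have hrm : 2 * ρ / 3 ≤ r₀ * m := by nlinarith
    have hprod : 3 * C / 4 * (2 * ρ / 3) ≤ g r₀ * (r₀ * m) :=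
      mul_le_mul hgr.le hrm (by positivity) (by linarith)
    have hact := mul_le_mul_of_nonneg_left hprod Real.two_pi_pos.le
    have hfn : 0 ≤ f r₀ * ℓ * n := by positivity
    linarith
end
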